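/- Under the standing assumptions (Θ nonempty convex with K < ∞, C closed convex containing 0, C∩C^0 compact), let θ ∈ Θ and let ŷ^θ be a maximizer of y ↦ g^θ(y) over C∩C^0. Then sup_{y∈C∩C^0} g^θ(y) = lim_{n→∞} sup_{y∈C∩C^0_n} g^θ(y) = lim_{n→∞} g^θ((1−1/n)·ŷ^θ). -/

import Mathlib

open MeasureTheory Filter Set
open scoped ENNReal NNReal Topology

noncomputable section

/-- The positive part of an extended real number, as an element of `ℝ≥0∞`. -/
def EReal.posPart (x : EReal) : ℝ≥0∞ := if x = ⊤ then ⊤ else ENNReal.ofReal x.toReal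

/-- Integral of an `EReal`-valued function, defined as the difference of the lintegrals of
the positive and negative parts, with the conventions of `EReal` arithmetic
(in particular `∞ - ∞ = -∞`). -/
def eIntegral {α : Type*} [MeasurableSpace α] (F : Measure α) (f : α → EReal) : EReal :=
  ((∫⁻ z, (f z).posPart ∂F : ℝ≥0∞) : EReal) - ((∫⁻ z, (-(f z)).posPart ∂F : ℝ≥0∞) : EReal)

/-- The dot product `y^⊤ z` on `ℝ^d`. -/
def dotp {d : ℕ} (y z : EuclideanSpace ℝ (Fin d)) : ℝ := ∑ i, y i * z i

/-- The quadratic form `y^⊤ c y`. -/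
def quadf {d : ℕ} (c : Matrix (Fin d) (Fin d) ℝ) (y : EuclideanSpace ℝ (Fin d)) : ℝ :=
  ∑ i, ∑ j, c i j * y i * y j

/-- The (Frobenius) norm `|c|` of a matrix. -/
def matNorm {d : ℕ} (c : Matrix (Fin d) (Fin d) ℝ) : ℝ :=
  Real.sqrt (∑ i, ∑ j, (c i j) ^ 2)

/-- A Lévy measure on `ℝ^d`: a (Borel) measure with `F({0}) = 0` and `∫ |z|² ∧ 1 F(dz) < ∞`. -/
def IsLevyMeasure {d : ℕ} (F : Measure (EuclideanSpace ℝ (Fin d))) : Prop :=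
  F {0} = 0 ∧ ∫⁻ z, ENNReal.ofReal (min (‖z‖ ^ 2) 1) ∂F < ⊤

/-- A truncation function: bounded, measurable, equal to the identity near the origin. -/
structure IsTruncation {d : ℕ}
    (h : EuclideanSpace ℝ (Fin d) → EuclideanSpace ℝ (Fin d)) : Prop where
  measurable : Measurable h
  bounded : ∃ M : ℝ, ∀ z, ‖h z‖ ≤ M
  eq_id_near_zero : ∃ δ : ℝ, 0 < δ ∧ ∀ z, ‖z‖ < δ → h z = z

/-- The integrand `I_y(z)`, as an extended real number:
`log(1+y^⊤z) - y^⊤h(z)` if `p = 0`, and `p⁻¹(1+y^⊤z)^p - p⁻¹ - y^⊤h(z)` if `p ≠ 0`,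
with the conventions `log 0 = -∞` and `0^p = +∞` for `p < 0` (so that the integrand
is `-∞` on `{1 + y^⊤z ≤ 0}` when `p ≤ 0`). -/
def Ifun {d : ℕ} (p : ℝ) (h : EuclideanSpace ℝ (Fin d) → EuclideanSpace ℝ (Fin d))
    (y z : EuclideanSpace ℝ (Fin d)) : EReal :=
  if 0 < 1 + dotp y z then
    (if p = 0 then ((Real.log (1 + dotp y z) - dotp y (h z) : ℝ) : EReal)
      else ((p⁻¹ * (1 + dotp y z) ^ p - p⁻¹ - dotp y (h z) : ℝ) : EReal))
  else if p ≤ 0 then (⊥ : EReal)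
  else ((p⁻¹ * (1 + dotp y z) ^ p - p⁻¹ - dotp y (h z) : ℝ) : EReal)

/-- The function `g^{(b,c,F)}(y) = y^⊤b + ((p-1)/2)·y^⊤cy + ∫ I_y(z) F(dz)`. -/
def gfun {d : ℕ} (p : ℝ) (h : EuclideanSpace ℝ (Fin d) → EuclideanSpace ℝ (Fin d))
    (b : EuclideanSpace ℝ (Fin d)) (c : Matrix (Fin d) (Fin d) ℝ)
    (F : Measure (EuclideanSpace ℝ (Fin d))) (y : EuclideanSpace ℝ (Fin d)) : EReal :=
  ((dotp y b + (p - 1) / 2 * quadf c y : ℝ) : EReal) + eIntegral F (fun z => Ifun p h y z)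

/-- Triples `θ = (b, c, F)`. -/
abbrev Triple (d : ℕ) :=
  EuclideanSpace ℝ (Fin d) × Matrix (Fin d) (Fin d) ℝ × Measure (EuclideanSpace ℝ (Fin d))

/-- `g^θ(y)` for a triple `θ = (b,c,F)`. -/
def gTheta {d : ℕ} (p : ℝ) (h : EuclideanSpace ℝ (Fin d) → EuclideanSpace ℝ (Fin d))
    (θ : Triple d) (y : EuclideanSpace ℝ (Fin d)) : EReal :=
  gfun p h θ.1 θ.2.1 θ.2.2 y

/-- The integrand appearing in the definition of the constant `K`, depending on `p`
(and an extra parameter `ε > 0` when `p ∈ (0,1)`). -/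
def Kintegrand {d : ℕ} (p ε : ℝ) (z : EuclideanSpace ℝ (Fin d)) : ℝ :=
  if p = 0 then min (‖z‖ ^ 2) (Real.log (1 + ‖z‖))
  else if 0 < p then min (‖z‖ ^ 2) (‖z‖ ^ (p * (1 + ε)))
  else min (‖z‖ ^ 2) 1

/-- The natural constraints `C⁰ = ∩_{F ∈ L_Θ} {y : F({z : y^⊤z < -1}) = 0}`. -/
def natC {d : ℕ} (Θ : Set (Triple d)) : Set (EuclideanSpace ℝ (Fin d)) :=
  {y | ∀ θ ∈ Θ, θ.2.2 {z | dotp y z < -1} = 0}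

/-- The sets `C⁰ₙ = ∩_{F ∈ L_Θ} {y : F({z : y^⊤z < -1 + 1/n}) = 0}`. -/
def natCn {d : ℕ} (Θ : Set (Triple d)) (n : ℕ) : Set (EuclideanSpace ℝ (Fin d)) :=
  {y | ∀ θ ∈ Θ, θ.2.2 {z | dotp y z < -1 + 1 / (n : ℝ)} = 0}

/-- The finite measure `|z|² ∧ 1 · F`. -/
def sq1Measure {d : ℕ} (F : Measure (EuclideanSpace ℝ (Fin d))) :
    Measure (EuclideanSpace ℝ (Fin d)) :=
  F.withDensity (fun z => ENNReal.ofReal (min (‖z‖ ^ 2) 1))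

/-- The standing assumptions of the paper: `p = 0` or `p ∈ (-∞,0) ∪ (0,1)`, `ε > 0`,
`h` is a truncation function, `Θ` is a nonempty convex set of Lévy triplets with `K < ∞`,
`C` is closed, convex and contains `0`, and `C ∩ C⁰` is compact. -/
structure Standing {d : ℕ} (p ε : ℝ)
    (h : EuclideanSpace ℝ (Fin d) → EuclideanSpace ℝ (Fin d))
    (Θ : Set (Triple d)) (C : Set (EuclideanSpace ℝ (Fin d))) : Prop where
  p_range : p = 0 ∨ p < 0 ∨ (0 < p ∧ p < 1)
  eps_pos : 0 < ε
  trunc : IsTruncation h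
  Theta_nonempty : Θ.Nonempty
  Theta_psd : ∀ θ ∈ Θ, (θ.2.1).PosSemidef
  Theta_levy : ∀ θ ∈ Θ, IsLevyMeasure θ.2.2
  Theta_convex : ∀ θ₁ ∈ Θ, ∀ θ₂ ∈ Θ, ∀ t : ℝ, 0 ≤ t → t ≤ 1 →
    (t • θ₁.1 + (1 - t) • θ₂.1, t • θ₁.2.1 + (1 - t) • θ₂.2.1,
      ENNReal.ofReal t • θ₁.2.2 + ENNReal.ofReal (1 - t) • θ₂.2.2) ∈ Θ
  K_finite : ∃ K : ℝ, ∀ θ ∈ Θ,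
    (∫⁻ z, ENNReal.ofReal (Kintegrand p ε z) ∂θ.2.2) ≠ ⊤ ∧
    ‖θ.1‖ + matNorm θ.2.1 + (∫⁻ z, ENNReal.ofReal (Kintegrand p ε z) ∂θ.2.2).toReal ≤ K
  C_closed : IsClosed C
  C_convex : Convex ℝ C
  C_zero : (0 : EuclideanSpace ℝ (Fin d)) ∈ C
  CC0_compact : IsCompact (C ∩ natC Θ)

/-- The increment `U(1 + x) - U(1)` of the logarithmic (`p = 0`) or power utility `U`. -/
def utilityIncr (p x : ℝ) : ℝ :=
  if p = 0 then Real.log (1 + x) else p⁻¹ * (1 + x) ^ p - p⁻¹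

lemma dotp_eq_inner {d : ℕ} (y z : EuclideanSpace ℝ (Fin d)) : dotp y z = inner ℝ z y := by
  simp [dotp, PiLp.inner_apply]

lemma dotp_smul_left {d : ℕ} (t : ℝ) (y z : EuclideanSpace ℝ (Fin d)) :
    dotp (t • y) z = t * dotp y z := by
  simp [dotp_eq_inner, inner_smul_right]

lemma abs_dotp_le {d : ℕ} (y z : EuclideanSpace ℝ (Fin d)) : |dotp y z| ≤ ‖y‖ * ‖z‖ := by
  rw [dotp_eq_inner, mul_comm]
  exact abs_real_inner_le_norm z y

lemma measurable_dotp {d : ℕ} (y : EuclideanSpace ℝ (Fin d)) : Measurable (dotp y) := by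
  have : dotp y = fun z => inner ℝ z y := funext (dotp_eq_inner y)
  rw [this]
  fun_prop

lemma quadf_smul {d : ℕ} (c : Matrix (Fin d) (Fin d) ℝ) (t : ℝ)
    (y : EuclideanSpace ℝ (Fin d)) : quadf c (t • y) = t ^ 2 * quadf c y := by
  simp only [quadf, PiLp.smul_apply, smul_eq_mul, Finset.mul_sum]
  refine Finset.sum_congr rfl fun i _ => Finset.sum_congr rfl fun j _ => ?_
  ring

section Utility

variable {p : ℝ}

lemma utilityIncr_zero_left (x : ℝ) : utilityIncr 0 x = Real.log (1 + x) := by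
  simp [utilityIncr]

lemma utilityIncr_of_ne (hp : p ≠ 0) (x : ℝ) :
    utilityIncr p x = p⁻¹ * (1 + x) ^ p - p⁻¹ := by
  simp [utilityIncr, hp]

lemma utilityIncr_mono {u v : ℝ} (hu : -1 ≤ u) (hadm : 0 < 1 + u ∨ 0 < p) (huv : u ≤ v) :
    utilityIncr p u ≤ utilityIncr p v := by
  rcases lt_trichotomy p 0 with hp | rfl | hp
  · have hu' : 0 < 1 + u := hadm.resolve_right hp.not_gt
    rw [utilityIncr_of_ne hp.ne, utilityIncr_of_ne hp.ne]
    have h1 : (1 + v) ^ p ≤ (1 + u) ^ p :=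
      Real.rpow_le_rpow_of_nonpos hu' (by linarith) hp.le
    have h2 := mul_le_mul_of_nonpos_left h1 (inv_neg''.2 hp).le
    linarith
  · have hu' : 0 < 1 + u := hadm.resolve_right (lt_irrefl _)
    rw [utilityIncr_zero_left, utilityIncr_zero_left]
    exact Real.log_le_log hu' (by linarith)
  · rw [utilityIncr_of_ne hp.ne', utilityIncr_of_ne hp.ne']
    have h1 : (1 + u) ^ p ≤ (1 + v) ^ p :=
      Real.rpow_le_rpow (by linarith) (by linarith) hp.le
    have h2 := mul_le_mul_of_nonneg_left h1 (inv_pos.2 hp).le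
    linarith

lemma utilityIncr_le_self (hp1 : p < 1) {u : ℝ} (hu : -1 ≤ u) (hadm : 0 < 1 + u ∨ 0 < p) :
    utilityIncr p u ≤ u := by
  rcases lt_trichotomy p 0 with hp | rfl | hp
  · have hu' : 0 < 1 + u := hadm.resolve_right hp.not_gt
    rw [utilityIncr_of_ne hp.ne]
    have h1 : 1 + p * u ≤ (1 + u) ^ p := by
      rw [Real.rpow_def_of_pos hu']
      have h2 := Real.add_one_le_exp (Real.log (1 + u) * p)
      have h3 := Real.log_le_sub_one_of_pos hu'
      nlinarith
    have h2 := mul_le_mul_of_nonpos_left h1 (inv_neg''.2 hp).le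
    have h3 : p⁻¹ * (1 + p * u) = p⁻¹ + u := by field_simp [hp.ne]
    linarith
  · have hu' : 0 < 1 + u := hadm.resolve_right (lt_irrefl _)
    rw [utilityIncr_zero_left]
    linarith [Real.log_le_sub_one_of_pos hu']
  · rw [utilityIncr_of_ne hp.ne']
    have h1 := rpow_one_add_le_one_add_mul_self hu hp.le hp1.le
    have h2 := mul_le_mul_of_nonneg_left h1 (inv_pos.2 hp).le
    have h3 : p⁻¹ * (1 + p * u) = p⁻¹ + u := by field_simp [hp.ne']
    linarith

lemma mul_utilityIncr_le (hp1 : p < 1) {x t : ℝ} (hx : -1 ≤ x) (hadm : 0 < 1 + x ∨ 0 < p)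
    (ht0 : 0 ≤ t) (ht1 : t ≤ 1) : t * utilityIncr p x ≤ utilityIncr p (t * x) := by
  have hcomb : 1 + t * x = t * (1 + x) + (1 - t) * 1 := by ring
  rcases lt_trichotomy p 0 with hp | rfl | hp
  · have hx' : 0 < 1 + x := hadm.resolve_right hp.not_gt
    rw [utilityIncr_of_ne hp.ne, utilityIncr_of_ne hp.ne]
    have h1 : (1 + x) ^ t ≤ 1 + t * x := by
      have := Real.geom_mean_le_arith_mean2_weighted ht0 (sub_nonneg.2 ht1) hx'.le
        zero_le_one (by ring)
      rwa [Real.one_rpow, mul_one, ← hcomb] at this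
    have h2 : (1 + t * x) ^ p ≤ ((1 + x) ^ t) ^ p :=
      Real.rpow_le_rpow_of_nonpos (Real.rpow_pos_of_pos hx' t) h1 hp.le
    have h3 : ((1 + x) ^ t) ^ p ≤ t * (1 + x) ^ p + (1 - t) := by
      have := Real.geom_mean_le_arith_mean2_weighted ht0 (sub_nonneg.2 ht1)
        (Real.rpow_nonneg hx'.le p) zero_le_one (by ring)
      rwa [Real.one_rpow, mul_one, mul_one, ← Real.rpow_mul hx'.le, mul_comm p,
        Real.rpow_mul hx'.le] at this
    have h4 := mul_le_mul_of_nonpos_left (h2.trans h3) (inv_neg''.2 hp).le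
    linarith
  · have hx' : 0 < 1 + x := hadm.resolve_right (lt_irrefl _)
    rw [utilityIncr_zero_left, utilityIncr_zero_left, hcomb]
    have := strictConcaveOn_log_Ioi.concaveOn.2 (mem_Ioi.2 hx') (mem_Ioi.2 one_pos) ht0
      (sub_nonneg.2 ht1) (by ring)
    simpa using this
  · rw [utilityIncr_of_ne hp.ne', utilityIncr_of_ne hp.ne']
    have := (Real.concaveOn_rpow hp.le hp1.le).2 (x := 1 + x) (y := 1)
      (mem_Ici.2 (by linarith)) (mem_Ici.2 zero_le_one) ht0 (sub_nonneg.2 ht1) (by ring)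
    simp only [smul_eq_mul, Real.one_rpow] at this
    rw [← hcomb] at this
    have h2 := mul_le_mul_of_nonneg_left this (inv_pos.2 hp).le
    linarith

lemma continuousAt_utilityIncr {x : ℝ} (hadm : 0 < 1 + x ∨ 0 < p) :
    ContinuousAt (utilityIncr p) x := by
  have hid : ContinuousAt (fun u : ℝ => 1 + u) x := by fun_prop
  by_cases hp : p = 0
  · subst hp
    have hx : 0 < 1 + x := hadm.resolve_right (lt_irrefl _)
    rw [funext utilityIncr_zero_left]
    exact hid.log hx.ne'
  · rw [funext (utilityIncr_of_ne hp)]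
    exact ((hid.rpow_const (hadm.imp ne_of_gt le_of_lt)).const_mul _).sub_const _

lemma tendsto_utilityIncr_atBot (hp : p ≤ 0) :
    Tendsto (utilityIncr p) (𝓝[>] (-1)) atBot := by
  have hid : Tendsto (fun u : ℝ => 1 + u) (𝓝[>] (-1)) (𝓝[>] 0) := by
    refine tendsto_nhdsWithin_iff.2 ⟨?_, ?_⟩
    · have : Tendsto (fun u : ℝ => 1 + u) (𝓝 (-1)) (𝓝 (1 + -1)) := by
        exact (continuous_const.add continuous_id).tendsto _
      rw [add_neg_cancel] at this
      exact this.mono_left nhdsWithin_le_nhds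
    · filter_upwards [self_mem_nhdsWithin] with u hu
      have : -1 < u := hu
      exact mem_Ioi.2 (by linarith)
  rcases hp.lt_or_eq with hp | rfl
  · rw [funext (utilityIncr_of_ne hp.ne)]
    exact tendsto_atBot_add_const_right _ _
      (((tendsto_rpow_neg_nhdsGT_zero hp).comp hid).const_mul_atTop_of_neg (inv_neg''.2 hp))
  · rw [funext utilityIncr_zero_left]
    exact Real.tendsto_log_nhdsGT_zero.comp hid

end Utility

lemma Ifun_eq_coe {d : ℕ} {p : ℝ} {h : EuclideanSpace ℝ (Fin d) → EuclideanSpace ℝ (Fin d)}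
    {y z : EuclideanSpace ℝ (Fin d)} (hadm : 0 < 1 + dotp y z ∨ 0 < p) :
    Ifun p h y z = ((utilityIncr p (dotp y z) - dotp y (h z) : ℝ) : EReal) := by
  unfold Ifun utilityIncr
  by_cases hx : 0 < 1 + dotp y z
  · by_cases hp : p = 0 <;> simp [hx, hp]
  · have hp : 0 < p := hadm.resolve_left hx
    simp [hx, hp.not_ge, hp.ne']

lemma Ifun_eq_bot {d : ℕ} {p : ℝ} {h : EuclideanSpace ℝ (Fin d) → EuclideanSpace ℝ (Fin d)}
    {y z : EuclideanSpace ℝ (Fin d)} (hx : ¬ 0 < 1 + dotp y z) (hp : p ≤ 0) :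
    Ifun p h y z = ⊥ := by
  simp [Ifun, hx, hp]

lemma measurable_Ifun {d : ℕ} {p : ℝ}
    {h : EuclideanSpace ℝ (Fin d) → EuclideanSpace ℝ (Fin d)} (hh : Measurable h)
    (y : EuclideanSpace ℝ (Fin d)) : Measurable (Ifun p h y) := by
  have h1 := measurable_dotp y
  have h2 : Measurable fun z => dotp y (h z) := h1.comp hh
  have h3 : Measurable fun z => Real.log (1 + dotp y z) - dotp y (h z) := by fun_prop
  have h4 : Measurable fun z => p⁻¹ * (1 + dotp y z) ^ p - p⁻¹ - dotp y (h z) := by fun_prop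
  unfold Ifun
  refine Measurable.ite (measurableSet_lt measurable_const (h1.const_add 1)) ?_ ?_
  · by_cases hp : p = 0
    · simpa [hp] using h3.coe_real_ereal
    · simpa [hp] using h4.coe_real_ereal
  · by_cases hp : p ≤ 0
    · simp [hp]
    · simpa [hp] using h4.coe_real_ereal

lemma EReal.posPart_eq_toENNReal (x : EReal) : x.posPart = x.toENNReal := rfl

lemma tendsto_Ifun_smul {d : ℕ} {p : ℝ}
    {h : EuclideanSpace ℝ (Fin d) → EuclideanSpace ℝ (Fin d)}
    {y z : EuclideanSpace ℝ (Fin d)} (hx : -1 ≤ dotp y z) {t : ℕ → ℝ}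
    (ht : Tendsto t atTop (𝓝 1)) (ht1 : ∀ᶠ n in atTop, t n < 1) :
    Tendsto (fun n => Ifun p h (t n • y) z) atTop (𝓝 (Ifun p h y z)) := by
  have hxt : Tendsto (fun n => t n * dotp y z) atTop (𝓝 (dotp y z)) := by
    simpa using ht.mul_const (dotp y z)
  have hkt : Tendsto (fun n => t n * dotp y (h z)) atTop (𝓝 (dotp y (h z))) := by
    simpa using ht.mul_const (dotp y (h z))
  by_cases hadm : 0 < 1 + dotp y z ∨ 0 < p
  · rw [Ifun_eq_coe hadm]
    have hev : ∀ᶠ n in atTop, 0 < 1 + t n * dotp y z ∨ 0 < p := by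
      rcases hadm with hpos | hp
      · filter_upwards [(hxt.const_add 1).eventually_const_lt hpos] with n hn using Or.inl hn
      · exact Eventually.of_forall fun _ => Or.inr hp
    refine (EReal.tendsto_coe.2
      (((continuousAt_utilityIncr hadm).tendsto.comp hxt).sub hkt)).congr' ?_
    filter_upwards [hev] with n hn
    rw [Ifun_eq_coe (by rwa [dotp_smul_left]), dotp_smul_left, dotp_smul_left]
    rfl
  · push Not at hadm
    obtain ⟨hx', hp⟩ := hadm
    have hxe : dotp y z = -1 := by linarith
    rw [Ifun_eq_bot hx'.not_gt hp]
    have hxt' : Tendsto (fun n => t n * dotp y z) atTop (𝓝[>] (-1)) := by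
      refine tendsto_nhdsWithin_iff.2 ⟨by rwa [hxe] at hxt ⊢, ?_⟩
      filter_upwards [ht1] with n hn
      rw [hxe, mem_Ioi]
      linarith
    have hbot : Tendsto (fun n => utilityIncr p (t n * dotp y z) - t n * dotp y (h z))
        atTop atBot := by
      simp only [sub_eq_add_neg]
      exact ((tendsto_utilityIncr_atBot hp).comp hxt').atBot_add hkt.neg
    refine (EReal.tendsto_coe_nhds_bot_iff.2 hbot).congr' ?_
    filter_upwards [ht1] with n hn
    rw [Ifun_eq_coe (by rw [dotp_smul_left, hxe]; left; linarith), dotp_smul_left,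
      dotp_smul_left]

lemma posPart_neg_Ifun_smul_le {d : ℕ} {p : ℝ} (hp1 : p < 1)
    {h : EuclideanSpace ℝ (Fin d) → EuclideanSpace ℝ (Fin d)}
    {y z : EuclideanSpace ℝ (Fin d)} (hx : -1 ≤ dotp y z) {t : ℝ} (ht0 : 0 ≤ t) (ht1 : t ≤ 1) :
    (-(Ifun p h (t • y) z)).posPart ≤ (-(Ifun p h y z)).posPart := by
  by_cases hadm : 0 < 1 + dotp y z ∨ 0 < p
  · have hadm' : 0 < 1 + dotp (t • y) z ∨ 0 < p := by
      rw [dotp_smul_left]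
      refine hadm.imp_left fun hpos => ?_
      rcases ht0.eq_or_lt with rfl | ht0
      · simp
      · nlinarith
    rw [Ifun_eq_coe hadm, Ifun_eq_coe hadm', dotp_smul_left, dotp_smul_left,
      EReal.posPart_eq_toENNReal, EReal.posPart_eq_toENNReal, ← EReal.coe_neg, ← EReal.coe_neg,
      EReal.real_coe_toENNReal, EReal.real_coe_toENNReal, ENNReal.ofReal_le_ofReal_iff']
    have hconc := mul_utilityIncr_le hp1 hx hadm ht0 ht1
    rcases le_or_gt 0 (utilityIncr p (dotp y z) - dotp y (h z)) with hs | hs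
    · right
      nlinarith
    · left
      nlinarith
  · push Not at hadm
    rw [Ifun_eq_bot hadm.1.not_gt hadm.2]
    simp [EReal.posPart_eq_toENNReal]

lemma utilityIncr_mul_norm_le {d : ℕ} {p ε R : ℝ} (hp1 : p < 1) (hε : 0 < ε) (hR : 0 ≤ R) :
    ∃ A B : ℝ, 0 ≤ A ∧ 0 ≤ B ∧ ∀ z : EuclideanSpace ℝ (Fin d),
      utilityIncr p (R * ‖z‖) ≤ A + B * Kintegrand p ε z := by
  rcases lt_trichotomy p 0 with hp | rfl | hp
  · refine ⟨-p⁻¹, 0, by linarith [inv_neg''.2 hp], le_rfl, fun z => ?_⟩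
    rw [utilityIncr_of_ne hp.ne]
    have h1 : 0 ≤ (1 + R * ‖z‖) ^ p := by positivity
    nlinarith [inv_neg''.2 hp]
  · refine ⟨Real.log (1 + R) + 1, 1, ?_, zero_le_one, fun z => ?_⟩
    · linarith [Real.log_nonneg (by linarith : (1 : ℝ) ≤ 1 + R)]
    rw [utilityIncr_zero_left]
    have hz := norm_nonneg z
    have h1 : Real.log (1 + R * ‖z‖) ≤ Real.log (1 + R) + Real.log (1 + ‖z‖) := by
      rw [← Real.log_mul (by positivity) (by positivity)]
      exact Real.log_le_log (by positivity) (by nlinarith [mul_nonneg hR hz])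
    have h2 : Real.log (1 + ‖z‖) ≤ 1 + Kintegrand 0 ε z := by
      simp only [Kintegrand, if_true]
      have h3 := Real.log_le_sub_one_of_pos (by positivity : 0 < 1 + ‖z‖)
      rcases le_total (‖z‖ ^ 2) (Real.log (1 + ‖z‖)) with h4 | h4
      · rw [min_eq_left h4]
        nlinarith [sq_nonneg (‖z‖ - 1)]
      · rw [min_eq_right h4]
        linarith
    linarith
  · have hRp : 0 ≤ p⁻¹ * R ^ p := by positivity
    refine ⟨p⁻¹ * R ^ p, p⁻¹ * R ^ p, hRp, hRp, fun z => ?_⟩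
    rw [utilityIncr_of_ne hp.ne']
    have hz := norm_nonneg z
    have h1 : (1 + R * ‖z‖) ^ p ≤ 1 + R ^ p * ‖z‖ ^ p := by
      have := Real.rpow_add_le_add_rpow zero_le_one (mul_nonneg hR hz) hp.le hp1.le
      rwa [Real.one_rpow, Real.mul_rpow hR hz] at this
    have h2 : ‖z‖ ^ p ≤ 1 + Kintegrand p ε z := by
      simp only [Kintegrand, hp.ne', if_false, hp, if_true]
      rcases le_total ‖z‖ 1 with h3 | h3
      · have h4 : ‖z‖ ^ p ≤ 1 := Real.rpow_le_one hz h3 hp.le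
        have h5 : 0 ≤ min (‖z‖ ^ 2) (‖z‖ ^ (p * (1 + ε))) := by positivity
        linarith
      · have h4 : ‖z‖ ^ p ≤ ‖z‖ ^ (p * (1 + ε)) :=
          Real.rpow_le_rpow_of_exponent_le h3 (by nlinarith)
        have h5 : ‖z‖ ^ p ≤ ‖z‖ ^ 2 := by
          rw [← Real.rpow_two]
          exact Real.rpow_le_rpow_of_exponent_le h3 (by linarith)
        linarith [le_min h5 h4]
    have h3 := mul_le_mul_of_nonneg_left h1 (inv_pos.2 hp).le
    have h4 := mul_le_mul_of_nonneg_left h2 hRp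
    linarith

lemma IsLevyMeasure.measure_norm_ge_lt_top {d : ℕ} {F : Measure (EuclideanSpace ℝ (Fin d))}
    (hF : IsLevyMeasure F) {δ : ℝ} (hδ : 0 < δ) : F {z | δ ≤ ‖z‖} < ⊤ := by
  have hδ' : 0 < min (δ ^ 2) 1 := by positivity
  have h1 := meas_ge_le_lintegral_div (μ := F)
    (f := fun z : EuclideanSpace ℝ (Fin d) => ENNReal.ofReal (min (‖z‖ ^ 2) 1)) (by fun_prop)
    (ENNReal.ofReal_pos.2 hδ').ne' ENNReal.ofReal_ne_top
  refine (measure_mono fun z hz => ?_).trans_lt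
    (h1.trans_lt (ENNReal.div_lt_top hF.2.ne (ENNReal.ofReal_pos.2 hδ').ne'))
  refine ENNReal.ofReal_le_ofReal (min_le_min_right _ ?_)
  exact pow_le_pow_left₀ hδ.le hz 2

/-- A dominating function for the positive parts of `I_{ty}`, uniformly in `t ∈ [0, 1]`. -/
lemma exists_bound_posPart_Ifun_smul {d : ℕ} {p ε : ℝ} (hp1 : p < 1) (hε : 0 < ε)
    {h : EuclideanSpace ℝ (Fin d) → EuclideanSpace ℝ (Fin d)} (hh : IsTruncation h)
    {F : Measure (EuclideanSpace ℝ (Fin d))} (hF : IsLevyMeasure F)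
    (hK : ∫⁻ z, ENNReal.ofReal (Kintegrand p ε z) ∂F ≠ ⊤) (y : EuclideanSpace ℝ (Fin d)) :
    ∃ G : EuclideanSpace ℝ (Fin d) → ℝ≥0∞, ∫⁻ z, G z ∂F ≠ ⊤ ∧
      ∀ z, -1 ≤ dotp y z → ∀ t : ℝ, 0 ≤ t → t ≤ 1 → (Ifun p h (t • y) z).posPart ≤ G z := by
  obtain ⟨M, hM⟩ := hh.bounded
  obtain ⟨δ, hδ, hid⟩ := hh.eq_id_near_zero
  obtain ⟨A, B, hA, hB, hAB⟩ := utilityIncr_mul_norm_le (d := d) hp1 hε (norm_nonneg y)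
  have hM0 : 0 ≤ M := (norm_nonneg _).trans (hM 0)
  have hS : MeasurableSet {z : EuclideanSpace ℝ (Fin d) | δ ≤ ‖z‖} :=
    measurableSet_le measurable_const measurable_norm
  refine ⟨fun z => {z | δ ≤ ‖z‖}.indicator (fun _ => ENNReal.ofReal (A + ‖y‖ * M)) z +
    ENNReal.ofReal B * ENNReal.ofReal (Kintegrand p ε z), ?_, fun z hx t ht0 ht1 => ?_⟩
  · rw [lintegral_add_left (measurable_const.indicator hS), lintegral_indicator_const hS,
      lintegral_const_mul' _ _ ENNReal.ofReal_ne_top]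
    exact ENNReal.add_ne_top.2 ⟨ENNReal.mul_ne_top ENNReal.ofReal_ne_top
      (hF.measure_norm_ge_lt_top hδ).ne, ENNReal.mul_ne_top ENNReal.ofReal_ne_top hK⟩
  · by_cases hadm : 0 < 1 + dotp (t • y) z ∨ 0 < p
    · rw [Ifun_eq_coe hadm, EReal.posPart_eq_toENNReal, EReal.real_coe_toENNReal]
      rw [dotp_smul_left] at hadm
      rw [dotp_smul_left, dotp_smul_left]
      have htx : -1 ≤ t * dotp y z := by nlinarith
      rcases lt_or_ge ‖z‖ δ with hz | hz
      · rw [hid z hz, ENNReal.ofReal_of_nonpos]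
        · exact zero_le
        · linarith [utilityIncr_le_self hp1 htx hadm]
      · beta_reduce
        rw [indicator_of_mem (show z ∈ {z | δ ≤ ‖z‖} from hz), ← ENNReal.ofReal_mul hB]
        refine le_trans (ENNReal.ofReal_le_ofReal ?_) ENNReal.ofReal_add_le
        have hyz := abs_dotp_le y z
        have hyh : |dotp y (h z)| ≤ ‖y‖ * M :=
          (abs_dotp_le y (h z)).trans (mul_le_mul_of_nonneg_left (hM z) (norm_nonneg y))
        have h1 : t * dotp y z ≤ ‖y‖ * ‖z‖ := by
          have h2 : t * dotp y z ≤ t * (‖y‖ * ‖z‖) :=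
            mul_le_mul_of_nonneg_left ((le_abs_self _).trans hyz) ht0
          have h3 : 0 ≤ ‖y‖ * ‖z‖ := by positivity
          nlinarith
        have h2 : -(t * dotp y (h z)) ≤ ‖y‖ * M := by
          have h3 : 0 ≤ ‖y‖ * M := by positivity
          have h4 := (abs_le.1 hyh).1
          nlinarith
        linarith [utilityIncr_mono htx hadm h1, hAB z]
    · push Not at hadm
      rw [Ifun_eq_bot hadm.1.not_gt hadm.2]
      simp [EReal.posPart_eq_toENNReal]

/-- `g` is continuous at the endpoint of the segment from `0` to `y`, even if `g(y) = -∞`. -/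
lemma tendsto_gfun_smul {d : ℕ} {p ε : ℝ} (hp1 : p < 1) (hε : 0 < ε)
    {h : EuclideanSpace ℝ (Fin d) → EuclideanSpace ℝ (Fin d)} (hh : IsTruncation h)
    (b : EuclideanSpace ℝ (Fin d)) (c : Matrix (Fin d) (Fin d) ℝ)
    {F : Measure (EuclideanSpace ℝ (Fin d))} (hF : IsLevyMeasure F)
    (hK : ∫⁻ z, ENNReal.ofReal (Kintegrand p ε z) ∂F ≠ ⊤) {y : EuclideanSpace ℝ (Fin d)}
    (hy : F {z | dotp y z < -1} = 0) {t : ℕ → ℝ} (ht0 : ∀ n, 0 ≤ t n) (ht1 : ∀ n, t n ≤ 1)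
    (hlt : ∀ᶠ n in atTop, t n < 1) (ht : Tendsto t atTop (𝓝 1)) :
    Tendsto (fun n => gfun p h b c F (t n • y)) atTop (𝓝 (gfun p h b c F y)) := by
  have hae : ∀ᵐ z ∂F, -1 ≤ dotp y z := by
    rw [ae_iff]
    simpa only [not_le] using hy
  have hmeas : ∀ u : EuclideanSpace ℝ (Fin d), Measurable (Ifun p h u) :=
    measurable_Ifun hh.measurable
  have hlim : ∀ᵐ z ∂F, Tendsto (fun n => Ifun p h (t n • y) z) atTop (𝓝 (Ifun p h y z)) :=
    hae.mono fun z hz => tendsto_Ifun_smul hz ht hlt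
  obtain ⟨G, hG, hle⟩ := exists_bound_posPart_Ifun_smul hp1 hε hh hF hK y
  have hpos : Tendsto (fun n => ∫⁻ z, (Ifun p h (t n • y) z).posPart ∂F) atTop
      (𝓝 (∫⁻ z, (Ifun p h y z).posPart ∂F)) :=
    tendsto_lintegral_of_dominated_convergence G (fun n => (hmeas _).ereal_toENNReal)
      (fun n => hae.mono fun z hz => hle z hz (t n) (ht0 n) (ht1 n)) hG
      (hlim.mono fun z hz => (EReal.continuous_toENNReal.tendsto _).comp hz)
  have hposfin : ∫⁻ z, (Ifun p h y z).posPart ∂F ≠ ⊤ := by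
    refine ne_top_of_le_ne_top hG (lintegral_mono_ae (hae.mono fun z hz => ?_))
    simpa using hle z hz 1 zero_le_one le_rfl
  have hneg : Tendsto (fun n => ∫⁻ z, (-(Ifun p h (t n • y) z)).posPart ∂F) atTop
      (𝓝 (∫⁻ z, (-(Ifun p h y z)).posPart ∂F)) := by
    refine tendsto_of_le_liminf_of_limsup_le ?_ ?_
    · calc ∫⁻ z, (-(Ifun p h y z)).posPart ∂F
          = ∫⁻ z, liminf (fun n => (-(Ifun p h (t n • y) z)).posPart) atTop ∂F :=
            lintegral_congr_ae (hlim.mono fun z hz => Eq.symm (Tendsto.liminf_eq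
              ((EReal.continuous_toENNReal.tendsto _).comp
                ((continuous_neg.tendsto _).comp hz))))
        _ ≤ _ := lintegral_liminf_le fun n => (hmeas _).neg.ereal_toENNReal
    · refine limsup_le_of_le (h := Eventually.of_forall fun n =>
        lintegral_mono_ae (hae.mono fun z hz => ?_))
      exact posPart_neg_Ifun_smul_le hp1 hz (ht0 n) (ht1 n)
  have hint : Tendsto (fun n => eIntegral F (Ifun p h (t n • y))) atTop
      (𝓝 (eIntegral F (Ifun p h y))) := by
    unfold eIntegral
    simp only [sub_eq_add_neg]
    refine (EReal.continuousAt_add (Or.inl ?_) (Or.inl ?_)).tendsto.comp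
      (((continuous_coe_ennreal_ereal.tendsto _).comp hpos).prodMk_nhds
        ((continuous_neg.tendsto _).comp ((continuous_coe_ennreal_ereal.tendsto _).comp hneg)))
    · simpa using hposfin
    · simp
  have hreal : Tendsto (fun n => dotp (t n • y) b + (p - 1) / 2 * quadf c (t n • y)) atTop
      (𝓝 (dotp y b + (p - 1) / 2 * quadf c y)) := by
    simp only [dotp_smul_left, quadf_smul]
    simpa using (ht.mul_const (dotp y b)).add
      (((ht.pow 2).mul_const (quadf c y)).const_mul ((p - 1) / 2))
  exact (EReal.continuousAt_add (Or.inl (EReal.coe_ne_top _))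
    (Or.inl (EReal.coe_ne_bot _))).tendsto.comp
    ((EReal.tendsto_coe.2 hreal).prodMk_nhds hint)

lemma natCn_subset_natC {d : ℕ} (Θ : Set (Triple d)) {n : ℕ} (hn : 1 ≤ n) :
    natCn Θ n ⊆ natC Θ := by
  intro y hy θ hθ
  refine measure_mono_null (fun z hz => ?_) (hy θ hθ)
  have h1 : (0 : ℝ) < 1 / (n : ℝ) := by positivity
  have h2 : dotp y z < -1 := hz
  show dotp y z < -1 + 1 / (n : ℝ)
  linarith

lemma smul_mem_natCn {d : ℕ} {Θ : Set (Triple d)} {y : EuclideanSpace ℝ (Fin d)}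
    (hy : y ∈ natC Θ) {n : ℕ} (hn : 1 ≤ n) : (1 - 1 / (n : ℝ)) • y ∈ natCn Θ n := by
  intro θ hθ
  refine measure_mono_null (fun z hz => ?_) (hy θ hθ)
  have h1 : 1 / (n : ℝ) ≤ 1 := by
    rw [div_le_one (by positivity)]
    exact_mod_cast hn
  have h2 : dotp ((1 - 1 / (n : ℝ)) • y) z < -1 + 1 / (n : ℝ) := hz
  rw [dotp_smul_left] at h2
  show dotp y z < -1
  by_contra! h3
  nlinarith

/-- Under the standing assumptions, if `θ ∈ Θ` and `yhat` maximizes `g^θ`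
over `C ∩ C⁰`, then `sup_{y ∈ C ∩ C⁰} g^θ(y) = lim_n sup_{y ∈ C ∩ C⁰ₙ} g^θ(y)
 = lim_n g^θ((1 - 1/n)·yhat)`. -/
theorem stmt6 {d : ℕ} (hd : 1 ≤ d) (p ε : ℝ)
    (h : EuclideanSpace ℝ (Fin d) → EuclideanSpace ℝ (Fin d))
    (Θ : Set (Triple d)) (C : Set (EuclideanSpace ℝ (Fin d)))
    (SA : Standing p ε h Θ C)
    (θ : Triple d) (hθ : θ ∈ Θ)
    (yhat : EuclideanSpace ℝ (Fin d)) (hyhat : yhat ∈ C ∩ natC Θ)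
    (hmax : ∀ y ∈ C ∩ natC Θ, gTheta p h θ y ≤ gTheta p h θ yhat) :
    Tendsto (fun n : ℕ => ⨆ y ∈ C ∩ natCn Θ n, gTheta p h θ y) atTop
      (nhds (⨆ y ∈ C ∩ natC Θ, gTheta p h θ y)) ∧
    Tendsto (fun n : ℕ => gTheta p h θ ((1 - 1 / (n : ℝ)) • yhat)) atTop
      (nhds (⨆ y ∈ C ∩ natC Θ, gTheta p h θ y)) := by
  have hp1 : p < 1 := by
    rcases SA.p_range with hp | hp | hp
    · linarith
    · linarith
    · exact hp.2
  have hsup : (⨆ y ∈ C ∩ natC Θ, gTheta p h θ y) = gTheta p h θ yhat :=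
    le_antisymm (iSup₂_le hmax) (le_iSup₂ (f := fun y _ => gTheta p h θ y) yhat hyhat)
  obtain ⟨K, hK⟩ := SA.K_finite
  have hbounds : ∀ n : ℕ, 0 ≤ 1 - 1 / (n : ℝ) ∧ 1 - 1 / (n : ℝ) ≤ 1 := by
    intro n
    have h1 : 0 ≤ 1 / (n : ℝ) := by positivity
    have h2 : 1 / (n : ℝ) ≤ 1 := by
      rw [one_div]
      exact Nat.cast_inv_le_one n
    constructor <;> linarith
  have hlt : ∀ᶠ n : ℕ in atTop, 1 - 1 / (n : ℝ) < 1 := by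
    filter_upwards [eventually_ge_atTop 1] with n hn
    have : 0 < 1 / (n : ℝ) := by positivity
    linarith
  have hseq : Tendsto (fun n : ℕ => 1 - 1 / (n : ℝ)) atTop (𝓝 1) := by
    simpa using tendsto_one_div_atTop_nhds_zero_nat.const_sub (1 : ℝ)
  have hlim : Tendsto (fun n : ℕ => gTheta p h θ ((1 - 1 / (n : ℝ)) • yhat)) atTop
      (𝓝 (gTheta p h θ yhat)) :=
    tendsto_gfun_smul hp1 SA.eps_pos SA.trunc θ.1 θ.2.1 (SA.Theta_levy θ hθ) (hK θ hθ).1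
      (hyhat.2 θ hθ) (fun n => (hbounds n).1) (fun n => (hbounds n).2) hlt hseq
  rw [hsup]
  refine ⟨tendsto_of_tendsto_of_tendsto_of_le_of_le' hlim tendsto_const_nhds ?_ ?_, hlim⟩
  · filter_upwards [eventually_ge_atTop 1] with n hn
    refine le_iSup₂ (f := fun y _ => gTheta p h θ y) ((1 - 1 / (n : ℝ)) • yhat)
      ⟨?_, smul_mem_natCn hyhat.2 hn⟩
    exact SA.C_convex.smul_mem_of_zero_mem SA.C_zero hyhat.1 (hbounds n)
  · filter_upwards [eventually_ge_atTop 1] with n hn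
    exact iSup₂_le fun y hy => hmax y ⟨hy.1, natCn_subset_natC Θ hn hy.2⟩
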